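/- arXiv:2004.02310 — 10 statements merged into one kernel-verified Lean document; each statement's English description precedes it below -/
import Mathlib

section
/- Let n ≥ 1 and let f : PD(n) → S be an affine invariant map from the set of n×n real positive definite matrices to an arbitrary set S, satisfying the scalar surjectivity condition {f(sI) : s ∈ (0,∞)} = S. Then f factors through the determinant: there exist a group G, a group homomorphism H from the multiplicative group of positive reals (0,∞) to G, and an injective map b from the range of H into S with range equal to S, such that f(M) = b(H(det M)) for every M ∈ PD(n). -/
open scoped Matrix

section AffineInvariant

variable {n : ℕ} {S : Type*} {f : Matrix (Fin n) (Fin n) ℝ → S}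

/-- A positive vector has a positive definite diagonal matrix. -/
theorem posDef_diagonal_positive (d : Fin n → {x : ℝ // 0 < x}) :
    (Matrix.diagonal fun i => (d i : ℝ)).PosDef :=
  Matrix.PosDef.diagonal fun i => (d i).2

/-- The value of an affine invariant map does not change under orthogonal congruence when all its
values are attained at scalar matrices. -/
theorem affineInvariant_orthogonal_congr
    (hinv : ∀ (M N A : Matrix (Fin n) (Fin n) ℝ), M.PosDef → N.PosDef → IsUnit A →
      f M = f N → f (Aᵀ * M * A) = f (Aᵀ * N * A))
    (hsurj : ∀ y : S, ∃ s : ℝ, 0 < s ∧ f (s • (1 : Matrix (Fin n) (Fin n) ℝ)) = y)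
    {M U : Matrix (Fin n) (Fin n) ℝ} (hM : M.PosDef) (hU : Uᵀ * U = 1) :
    f (Uᵀ * M * U) = f M := by
  obtain ⟨s, hs, h⟩ := hsurj (f M)
  have hunit : IsUnit U := IsUnit.of_mul_eq_one_right _ hU
  rw [hinv M _ U hM (Matrix.PosDef.one.smul hs) hunit h.symm]
  simp [hU, h]

theorem affineInvariant_diagonal_comp_perm
    (hinv : ∀ (M N A : Matrix (Fin n) (Fin n) ℝ), M.PosDef → N.PosDef → IsUnit A →
      f M = f N → f (Aᵀ * M * A) = f (Aᵀ * N * A))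
    (hsurj : ∀ y : S, ∃ s : ℝ, 0 < s ∧ f (s • (1 : Matrix (Fin n) (Fin n) ℝ)) = y)
    (d : Fin n → {x : ℝ // 0 < x}) (σ : Equiv.Perm (Fin n)) :
    f (Matrix.diagonal fun i => (d (σ i) : ℝ)) = f (Matrix.diagonal fun i => (d i : ℝ)) := by
  have hconj (D : Matrix (Fin n) (Fin n) ℝ) :
      ((1 : Matrix (Fin n) (Fin n) ℝ).submatrix id σ)ᵀ * D *
        (1 : Matrix (Fin n) (Fin n) ℝ).submatrix id σ = D.submatrix σ σ := by
    ext i j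
    simp [Matrix.mul_apply, Matrix.one_apply]
  rw [← affineInvariant_orthogonal_congr hinv hsurj (posDef_diagonal_positive d)
    (U := (1 : Matrix (Fin n) (Fin n) ℝ).submatrix id σ) (by simpa using hconj 1), hconj,
    Matrix.submatrix_diagonal_equiv]
  rfl

theorem affineInvariant_diagonal_mul
    (hinv : ∀ (M N A : Matrix (Fin n) (Fin n) ℝ), M.PosDef → N.PosDef → IsUnit A →
      f M = f N → f (Aᵀ * M * A) = f (Aᵀ * N * A))
    (c : Fin n → {x : ℝ // 0 < x}) {d e : Fin n → {x : ℝ // 0 < x}}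
    (h : f (Matrix.diagonal fun i => (d i : ℝ)) = f (Matrix.diagonal fun i => (e i : ℝ))) :
    f (Matrix.diagonal fun i => ((c * d) i : ℝ)) =
      f (Matrix.diagonal fun i => ((c * e) i : ℝ)) := by
  have hunit : IsUnit (Matrix.diagonal fun i => √(c i : ℝ)) :=
    (Matrix.PosDef.diagonal fun i => Real.sqrt_pos.2 (c i).2).isUnit
  have hconj (d : Fin n → {x : ℝ // 0 < x}) :
      (Matrix.diagonal fun i => √(c i : ℝ))ᵀ * (Matrix.diagonal fun i => (d i : ℝ)) *
        (Matrix.diagonal fun i => √(c i : ℝ)) = Matrix.diagonal fun i => ((c * d) i : ℝ) := by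
    rw [Matrix.diagonal_transpose, Matrix.diagonal_mul_diagonal, Matrix.diagonal_mul_diagonal]
    congr 1
    funext i
    rw [mul_right_comm, Real.mul_self_sqrt (c i).2.le]
    rfl
  simpa only [hconj] using
    hinv _ _ _ (posDef_diagonal_positive d) (posDef_diagonal_positive e) hunit h

/-- The congruence on positive vectors induced by an affine invariant map on diagonal matrices. -/
def affineInvariantCon
    (hinv : ∀ (M N A : Matrix (Fin n) (Fin n) ℝ), M.PosDef → N.PosDef → IsUnit A →
      f M = f N → f (Aᵀ * M * A) = f (Aᵀ * N * A)) :
    Con (Fin n → {x : ℝ // 0 < x}) where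
  toSetoid := Setoid.ker fun d => f (Matrix.diagonal fun i => (d i : ℝ))
  mul' {w x y z} hwx hyz := by
    refine (affineInvariant_diagonal_mul hinv w hyz).trans ?_
    rw [mul_comm w, mul_comm x]
    exact affineInvariant_diagonal_mul hinv z hwx

/-- A homomorphism invariant under permutations of coordinates only depends on the product. -/
theorem map_eq_map_mulSingle_prod {ι α G : Type*} [Fintype ι] [DecidableEq ι] [CommMonoid α]
    [CommMonoid G] (q : (ι → α) →* G)
    (hq : ∀ (d : ι → α) (σ : Equiv.Perm ι), q (fun i => d (σ i)) = q d) (j : ι) (d : ι → α) :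
    q d = q (Pi.mulSingle j (∏ i, d i)) := by
  have hsingle (i : ι) (x : α) : q (Pi.mulSingle i x) = q (Pi.mulSingle j x) := by
    rw [← hq (Pi.mulSingle j x) (Equiv.swap i j)]
    congr 1
    funext k
    simp only [Pi.mulSingle_apply, Equiv.swap_apply_eq_iff, Equiv.swap_apply_right]
  calc q d = ∏ i, q (Pi.mulSingle i (d i)) := by
        rw [← map_prod, Finset.univ_prod_mulSingle]
    _ = ∏ i, q (Pi.mulSingle j (d i)) := by simp only [hsingle]
    _ = q (Pi.mulSingle j (∏ i, d i)) :=
        (map_prod (q.comp (MonoidHom.mulSingle (fun _ : ι => α) j)) d Finset.univ).symm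

end AffineInvariant

theorem affine_invariant_factors_through_det
    {n : ℕ} (hn : 1 ≤ n) {S : Type*} (f : Matrix (Fin n) (Fin n) ℝ → S)
    (hinv : ∀ (M N A : Matrix (Fin n) (Fin n) ℝ), M.PosDef → N.PosDef → IsUnit A →
      f M = f N → f (Aᵀ * M * A) = f (Aᵀ * N * A))
    (hsurj : ∀ y : S, ∃ s : ℝ, 0 < s ∧ f (s • (1 : Matrix (Fin n) (Fin n) ℝ)) = y) :
    ∃ (G : Type) (inst : Group G),
      letI := inst
      ∃ (H : {x : ℝ // 0 < x} →* G) (b : Set.range H → S),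
        Function.Injective b ∧ Function.Surjective b ∧
        ∀ (M : Matrix (Fin n) (Fin n) ℝ) (hM : M.PosDef),
          f M = b ⟨H ⟨M.det, hM.det_pos⟩, Set.mem_range_self _⟩ := by
  let C := affineInvariantCon hinv
  let j : Fin n := ⟨0, hn⟩
  let F : C.Quotient → S := Quotient.lift (fun d => f (Matrix.diagonal fun i => (d i : ℝ)))
    fun _ _ h => h
  have hF : Function.Injective F := by
    rintro ⟨d⟩ ⟨e⟩ h
    exact Quotient.sound h
  let H : {x : ℝ // 0 < x} →* C.Quotient :=
    C.mk'.comp (MonoidHom.mulSingle (fun _ => {x : ℝ // 0 < x}) j)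
  have hperm (d : Fin n → {x : ℝ // 0 < x}) (σ : Equiv.Perm (Fin n)) :
      C.mk' (fun i => d (σ i)) = C.mk' d :=
    Quotient.sound (affineInvariant_diagonal_comp_perm hinv hsurj d σ)
  have hmk (d : Fin n → {x : ℝ // 0 < x}) : C.mk' d = H (∏ i, d i) :=
    map_eq_map_mulSingle_prod (G := C.Quotient) C.mk' hperm j d
  have hdiag (d : Fin n → {x : ℝ // 0 < x}) :
      F (H (∏ i, d i)) = f (Matrix.diagonal fun i => (d i : ℝ)) := by
    rw [← hmk]
    rfl
  refine ⟨C.Quotient, inferInstance, H, fun x => F x, hF.comp Subtype.val_injective, ?_, ?_⟩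
  · intro y
    obtain ⟨s, hs, rfl⟩ := hsurj y
    refine ⟨⟨H (∏ _i : Fin n, ⟨s, hs⟩), Set.mem_range_self _⟩, ?_⟩
    rw [Matrix.smul_one_eq_diagonal]
    exact hdiag fun _ => ⟨s, hs⟩
  · intro M hM
    let d : Fin n → {x : ℝ // 0 < x} := fun i => ⟨hM.1.eigenvalues i, hM.eigenvalues_pos i⟩
    let U : Matrix (Fin n) (Fin n) ℝ := hM.1.eigenvectorUnitary
    have hU : Uᵀ * U = 1 := Unitary.coe_star_mul_self hM.1.eigenvectorUnitary
    have hspec : Uᵀ * M * U = Matrix.diagonal fun i => (d i : ℝ) := by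
      have h := hM.1.spectral_theorem
      have h' : M = U * (Matrix.diagonal fun i => (d i : ℝ)) * Uᵀ := h
      rw [h', ← mul_assoc, ← mul_assoc, hU, one_mul, mul_assoc, hU, mul_one]
    have hdet : (⟨M.det, hM.det_pos⟩ : {x : ℝ // 0 < x}) = ∏ i, d i := by
      apply Subtype.ext
      have hcoe : ((∏ i, d i : {x : ℝ // 0 < x}) : ℝ) = ∏ i, (d i : ℝ) :=
        map_prod
          (⟨⟨Subtype.val, rfl⟩, fun _ _ => rfl⟩ : {x : ℝ // 0 < x} →* ℝ) d Finset.univ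
      rw [hcoe]
      exact hM.1.det_eq_prod_eigenvalues
    rw [← affineInvariant_orthogonal_congr hinv hsurj hM hU, hspec, ← hdiag, hdet]
end

section
/- Let n ≥ 1 and let f : PD(n) → S be an affine invariant map satisfying the scalar surjectivity condition. Then f is determined by the determinant: for all M, N ∈ PD(n), det(M) = det(N) implies f(M) = f(N). -/
open scoped Matrix

section RightInvariant

variable {ι S : Type*} [Fintype ι] [DecidableEq ι] {F : Matrix ι ι ℝ → S}

/-- A map whose fibres are stable under right multiplication, and which takes all its values on
nonzero scalar matrices, is insensitive to the order of multiplication. -/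
theorem apply_mul_comm_of_scalar_surjective
    (hR : ∀ A B C : Matrix ι ι ℝ, IsUnit A → IsUnit B → IsUnit C → F A = F B → F (A * C) = F (B * C))
    (hS : ∀ A : Matrix ι ι ℝ, IsUnit A → ∃ s : ℝ, s ≠ 0 ∧ F A = F (s • 1))
    {A B : Matrix ι ι ℝ} (hA : IsUnit A) (hB : IsUnit B) : F (A * B) = F (B * A) := by
  have hscalar : ∀ s : ℝ, s ≠ 0 → IsUnit (s • (1 : Matrix ι ι ℝ)) := fun s hs =>
    (isUnit_one (M := Matrix ι ι ℝ)).smul (Units.mk0 s hs)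
  obtain ⟨s, hs, hsA⟩ := hS A hA
  obtain ⟨t, ht, htB⟩ := hS B hB
  have key : ∀ (A B : Matrix ι ι ℝ) (s t : ℝ), IsUnit A → IsUnit B → s ≠ 0 → t ≠ 0 →
      F A = F (s • 1) → F B = F (t • 1) → F (A * B) = F ((s * t) • 1) := by
    intro A B s t hA hB hs ht hsA htB
    have h₁ := hR _ _ B hA (hscalar s hs) hB hsA
    have h₂ := hR _ _ (s • 1) hB (hscalar t ht) (hscalar s hs) htB
    simp only [smul_mul_assoc, mul_smul_comm, one_mul, mul_one, smul_smul] at h₁ h₂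
    exact h₁.trans h₂
  rw [key A B s t hA hB hs ht hsA htB, key B A t s hB hA ht hs htB hsA, mul_comm s t]

theorem isUnit_diagonal_of_ne_zero {d : ι → ℝ} (hd : ∀ i, d i ≠ 0) :
    IsUnit (Matrix.diagonal d) :=
  Matrix.isUnit_diagonal.2 (Pi.isUnit_iff.2 fun i => (hd i).isUnit)

theorem apply_diagonal_comp_perm
    (hO : ∀ U ∈ Matrix.orthogonalGroup ι ℝ, ∀ A, F (U * A) = F A)
    (hC : ∀ A B : Matrix ι ι ℝ, IsUnit A → IsUnit B → F (A * B) = F (B * A))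
    {d : ι → ℝ} (hd : ∀ i, d i ≠ 0) (σ : Equiv.Perm ι) :
    F (Matrix.diagonal (d ∘ σ)) = F (Matrix.diagonal d) := by
  have hmem : ∀ τ : Equiv.Perm ι, τ.permMatrix ℝ ∈ Matrix.orthogonalGroup ι ℝ := by
    intro τ
    rw [Matrix.mem_orthogonalGroup_iff, Matrix.transpose_permMatrix, ← Matrix.permMatrix_mul]
    simp
  have hunit : IsUnit (σ⁻¹.permMatrix ℝ) :=
    IsUnit.of_mul_eq_one _ (Matrix.mem_orthogonalGroup_iff _ _ |>.1 (hmem σ⁻¹))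
  have hconj : Matrix.diagonal (d ∘ σ) =
      σ.permMatrix ℝ * (Matrix.diagonal d * σ⁻¹.permMatrix ℝ) := by
    rw [← Matrix.submatrix_diagonal_equiv, ← mul_assoc]
    ext i j
    simp [Equiv.Perm.permMatrix, PEquiv.toMatrix_toPEquiv_mul, PEquiv.mul_toMatrix_toPEquiv]
    rfl
  rw [hconj, hO _ (hmem σ), hC _ _ (isUnit_diagonal_of_ne_zero hd) hunit, hO _ (hmem σ⁻¹)]

theorem apply_diagonal_eq_apply_diagonal_prod
    (hO : ∀ U ∈ Matrix.orthogonalGroup ι ℝ, ∀ A, F (U * A) = F A)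
    (hR : ∀ A B C : Matrix ι ι ℝ, IsUnit A → IsUnit B → IsUnit C → F A = F B → F (A * C) = F (B * C))
    (hC : ∀ A B : Matrix ι ι ℝ, IsUnit A → IsUnit B → F (A * B) = F (B * A))
    {d : ι → ℝ} (hd : ∀ i, d i ≠ 0) (k : ι) :
    F (Matrix.diagonal d) = F (Matrix.diagonal (Pi.mulSingle k (∏ i, d i))) := by
  have hne : ∀ (i : ι) {x : ℝ}, x ≠ 0 → ∀ j, (Pi.mulSingle i x : ι → ℝ) j ≠ 0 := by
    intro i x hx j
    rw [Pi.mulSingle_apply]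
    split_ifs <;> simp [hx]
  have hunit : ∀ (i : ι) {x : ℝ}, x ≠ 0 →
      IsUnit (Matrix.diagonal (Pi.mulSingle i x : ι → ℝ)) := fun i x hx =>
    isUnit_diagonal_of_ne_zero (hne i hx)
  have hmove : ∀ (i : ι) {x : ℝ}, x ≠ 0 →
      F (Matrix.diagonal (Pi.mulSingle i x)) = F (Matrix.diagonal (Pi.mulSingle k x)) := by
    intro i x hx
    rw [← apply_diagonal_comp_perm hO hC (hne k hx) (Equiv.swap i k)]
    congr 2
    ext j
    simp only [Function.comp_apply, Pi.mulSingle_apply]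
    congr 1
    rw [Equiv.swap_apply_eq_iff, Equiv.swap_apply_right]
  have hmul : ∀ u v : ι → ℝ,
      Matrix.diagonal (u * v) = Matrix.diagonal u * Matrix.diagonal v := fun u v =>
    (Matrix.diagonal_mul_diagonal u v).symm
  have hprod : ∀ s : Finset ι, F (Matrix.diagonal (∏ i ∈ s, Pi.mulSingle i (d i))) =
      F (Matrix.diagonal (Pi.mulSingle k (∏ i ∈ s, d i))) := by
    intro s
    induction s using Finset.induction_on with
    | empty => simp
    | insert a s ha ih =>
      have hs : ∏ i ∈ s, d i ≠ 0 := Finset.prod_ne_zero_iff.2 fun i _ => hd i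
      have hs' : IsUnit (Matrix.diagonal (∏ i ∈ s, Pi.mulSingle i (d i) : ι → ℝ)) :=
        isUnit_diagonal_of_ne_zero fun j => by
          rw [Finset.prod_apply]
          exact Finset.prod_ne_zero_iff.2 fun i _ => hne i (hd i) j
      have h₁ := hR _ _ _ hs' (hunit k hs) (hunit a (hd a)) ih
      have h₂ := hR _ _ _ (hunit a (hd a)) (hunit k (hd a)) (hunit k hs) (hmove a (hd a))
      rw [Finset.prod_insert ha, Finset.prod_insert ha, Pi.mulSingle_mul, mul_comm,
        hmul, h₁, hC _ _ (hunit k hs) (hunit a (hd a)), h₂, hmul]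
  have := hprod Finset.univ
  rwa [Finset.univ_prod_mulSingle] at this

end RightInvariant

theorem Matrix.PosDef.exists_transpose_mul_self_eq {ι : Type*} [Fintype ι] [DecidableEq ι]
    {M : Matrix ι ι ℝ} (hM : M.PosDef) :
    ∃ d : ι → ℝ, ∃ U ∈ Matrix.orthogonalGroup ι ℝ, (∀ i, d i ≠ 0) ∧
      ∏ i, d i = √M.det ∧ (Matrix.diagonal d * U)ᵀ * (Matrix.diagonal d * U) = M := by
  refine ⟨fun i => √(hM.1.eigenvalues i), star (hM.1.eigenvectorUnitary : Matrix ι ι ℝ),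
    Unitary.star_mem hM.1.eigenvectorUnitary.2, fun i => (Real.sqrt_pos.2 (hM.eigenvalues_pos i)).ne',
    ?_, ?_⟩
  · rw [hM.1.det_eq_prod_eigenvalues]
    exact (Real.sqrt_prod _ fun i _ => (hM.eigenvalues_pos i).le).symm
  · conv_rhs => rw [hM.1.spectral_theorem]
    rw [Matrix.transpose_mul, Matrix.diagonal_transpose, mul_assoc,
      ← mul_assoc (Matrix.diagonal _) (Matrix.diagonal _), Matrix.diagonal_mul_diagonal]
    simp only [Real.mul_self_sqrt (hM.eigenvalues_pos _).le]
    simp [Unitary.conjStarAlgAut_apply, Matrix.star_eq_conjTranspose, mul_assoc]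

theorem affine_invariant_det_determines
    {n : ℕ} (hn : 1 ≤ n) {S : Type*} (f : Matrix (Fin n) (Fin n) ℝ → S)
    (hinv : ∀ (M N A : Matrix (Fin n) (Fin n) ℝ), M.PosDef → N.PosDef → IsUnit A →
      f M = f N → f (Aᵀ * M * A) = f (Aᵀ * N * A))
    (hsurj : ∀ y : S, ∃ s : ℝ, 0 < s ∧ f (s • (1 : Matrix (Fin n) (Fin n) ℝ)) = y) :
    ∀ (M N : Matrix (Fin n) (Fin n) ℝ), M.PosDef → N.PosDef → M.det = N.det →
      f M = f N := by
  set F : Matrix (Fin n) (Fin n) ℝ → S := fun A => f (Aᵀ * A) with hF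
  have hpos : ∀ A : Matrix (Fin n) (Fin n) ℝ, IsUnit A → (Aᵀ * A).PosDef := fun A hA => by
    simpa using Matrix.PosDef.conjTranspose_mul_self A (Matrix.mulVec_injective_of_isUnit hA)
  have hO : ∀ U ∈ Matrix.orthogonalGroup (Fin n) ℝ, ∀ A, F (U * A) = F A := by
    intro U hU A
    have hU' : Uᵀ * U = 1 := (Matrix.mem_orthogonalGroup_iff' _ _).1 hU
    simp only [hF]
    rw [Matrix.transpose_mul, mul_assoc, ← mul_assoc Uᵀ, hU', one_mul]
  have hR : ∀ A B C : Matrix (Fin n) (Fin n) ℝ, IsUnit A → IsUnit B → IsUnit C →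
      F A = F B → F (A * C) = F (B * C) := by
    intro A B C hA hB hC h
    simpa [hF, mul_assoc] using hinv _ _ C (hpos A hA) (hpos B hB) hC h
  have hS : ∀ A : Matrix (Fin n) (Fin n) ℝ, IsUnit A → ∃ s : ℝ, s ≠ 0 ∧ F A = F (s • 1) := by
    intro A _
    obtain ⟨s, hs, h⟩ := hsurj (F A)
    refine ⟨√s, (Real.sqrt_pos.2 hs).ne', ?_⟩
    simp only [hF] at h ⊢
    simp [← h, smul_smul, Real.mul_self_sqrt hs.le]
  have hC : ∀ A B : Matrix (Fin n) (Fin n) ℝ, IsUnit A → IsUnit B → F (A * B) = F (B * A) :=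
    fun A B hA hB => apply_mul_comm_of_scalar_surjective hR hS hA hB
  have key : ∀ M : Matrix (Fin n) (Fin n) ℝ, M.PosDef →
      f M = F (Matrix.diagonal (Pi.mulSingle ⟨0, hn⟩ √M.det)) := by
    intro M hM
    obtain ⟨d, U, hU, hd, hdet, hMd⟩ := hM.exists_transpose_mul_self_eq
    have hUunit : IsUnit U := IsUnit.of_mul_eq_one _ ((Matrix.mem_orthogonalGroup_iff _ _).1 hU)
    calc f M = F (Matrix.diagonal d * U) := by simp only [hF, hMd]
      _ = F (Matrix.diagonal d) := by
        rw [hC _ _ (isUnit_diagonal_of_ne_zero hd) hUunit, hO U hU]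
      _ = _ := by rw [apply_diagonal_eq_apply_diagonal_prod hO hR hC hd ⟨0, hn⟩, hdet]
  intro M N hM hN hdet
  rw [key M hM, key N hN, hdet]
end

section
/- Let n ≥ 1 and let f : PD(n) → S be an affine invariant map satisfying the scalar surjectivity condition. Then for every M ∈ PD(n), f(M) = f((det M)^{1/n} · I), i.e., f agrees on M and on the scalar positive definite matrix with the same determinant as M. -/
open scoped Matrix

section AffineInvariant

variable {n : ℕ} {S : Type*} {f : Matrix (Fin n) (Fin n) ℝ → S}

theorem posDef_diagonal_exp (v : Fin n → ℝ) :
    (Matrix.diagonal fun i => Real.exp (v i)).PosDef :=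
  Matrix.PosDef.diagonal fun i => Real.exp_pos (v i)

theorem transpose_permMatrix_mul_diagonal_mul (σ : Equiv.Perm (Fin n)) (d : Fin n → ℝ) :
    ((σ⁻¹).permMatrix ℝ)ᵀ * Matrix.diagonal d * (σ⁻¹).permMatrix ℝ =
      Matrix.diagonal fun i => d (σ i) := by
  have hσ : Equiv.symm σ⁻¹ = σ := rfl
  rw [Matrix.transpose_permMatrix]
  ext i j
  simp [Equiv.Perm.permMatrix, PEquiv.toMatrix_toPEquiv_mul, PEquiv.mul_toMatrix_toPEquiv,
    Matrix.diagonal_apply, hσ]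

/-- Comparing `M` with a scalar matrix in the same fibre of `f` shows that `f` is invariant under
orthogonal conjugation. -/
theorem map_orthogonal_conj {M A : Matrix (Fin n) (Fin n) ℝ}
    (hinv : ∀ (M N A : Matrix (Fin n) (Fin n) ℝ), M.PosDef → N.PosDef → IsUnit A →
      f M = f N → f (Aᵀ * M * A) = f (Aᵀ * N * A))
    (hsurj : ∀ y : S, ∃ s : ℝ, 0 < s ∧ f (s • (1 : Matrix (Fin n) (Fin n) ℝ)) = y)
    (hM : M.PosDef) (hA : Aᵀ * A = 1) : f (Aᵀ * M * A) = f M := by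
  obtain ⟨s, hs, hfs⟩ := hsurj (f M)
  have hU : IsUnit A := IsUnit.of_mul_eq_one_right _ hA
  have h := hinv _ _ A hM (Matrix.PosDef.one.smul hs) hU hfs.symm
  simpa [hA, hfs] using h

theorem map_diagonal_exp_add {u v : Fin n → ℝ}
    (hinv : ∀ (M N A : Matrix (Fin n) (Fin n) ℝ), M.PosDef → N.PosDef → IsUnit A →
      f M = f N → f (Aᵀ * M * A) = f (Aᵀ * N * A))
    (w : Fin n → ℝ)
    (h : f (Matrix.diagonal fun i => Real.exp (u i)) =
      f (Matrix.diagonal fun i => Real.exp (v i))) :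
    f (Matrix.diagonal fun i => Real.exp (u i + w i)) =
      f (Matrix.diagonal fun i => Real.exp (v i + w i)) := by
  have hU : IsUnit (Matrix.diagonal fun i => Real.exp (w i / 2)) :=
    (posDef_diagonal_exp fun i => w i / 2).isUnit
  have key (x : Fin n → ℝ) : (Matrix.diagonal fun i => Real.exp (w i / 2))ᵀ *
      (Matrix.diagonal fun i => Real.exp (x i)) * (Matrix.diagonal fun i => Real.exp (w i / 2)) =
      Matrix.diagonal fun i => Real.exp (x i + w i) := by
    rw [Matrix.diagonal_transpose, Matrix.diagonal_mul_diagonal, Matrix.diagonal_mul_diagonal]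
    congr 1
    ext i
    rw [← Real.exp_add, ← Real.exp_add]
    ring_nf
  have := hinv _ _ _ (posDef_diagonal_exp u) (posDef_diagonal_exp v) hU h
  rwa [key, key] at this

theorem map_diagonal_exp_eq_mean
    (hinv : ∀ (M N A : Matrix (Fin n) (Fin n) ℝ), M.PosDef → N.PosDef → IsUnit A →
      f M = f N → f (Aᵀ * M * A) = f (Aᵀ * N * A))
    (hn : 1 ≤ n)
    (hsurj : ∀ y : S, ∃ s : ℝ, 0 < s ∧ f (s • (1 : Matrix (Fin n) (Fin n) ℝ)) = y)
    (v : Fin n → ℝ) :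
    f (Matrix.diagonal fun i => Real.exp (v i)) =
      f (Matrix.diagonal fun _ => Real.exp ((n : ℝ)⁻¹ * ∑ j, v j)) := by
  have : NeZero n := ⟨by omega⟩
  have hn0 : (n : ℝ) ≠ 0 := Nat.cast_ne_zero.mpr (NeZero.ne n)
  let H : AddSubmonoid (Fin n → ℝ) :=
    { carrier := {u | ∀ w : Fin n → ℝ, f (Matrix.diagonal fun i => Real.exp (u i + w i)) =
        f (Matrix.diagonal fun i => Real.exp (w i))}
      zero_mem' := fun w => by simp
      add_mem' := fun {a b} ha hb w => by
        have := ha (b + w)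
        simp only [Pi.add_apply, ← add_assoc] at this ⊢
        exact this.trans (hb w) }
  have hperm (σ : Equiv.Perm (Fin n)) (u : Fin n → ℝ) : (fun i => u i - u (σ i)) ∈ H := by
    intro w
    have hA : ((σ⁻¹).permMatrix ℝ)ᵀ * (σ⁻¹).permMatrix ℝ = 1 := by
      simpa using transpose_permMatrix_mul_diagonal_mul σ (fun _ => (1 : ℝ))
    have h := map_orthogonal_conj hinv hsurj (posDef_diagonal_exp u) hA
    rw [transpose_permMatrix_mul_diagonal_mul] at h
    have h2 := map_diagonal_exp_add hinv (fun i => w i - u (σ i)) h.symm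
    convert h2 using 5 <;> ring
  have hmem : (fun i => v i - (n : ℝ)⁻¹ * ∑ j, v j) ∈ H := by
    have hsum := sum_mem (S := H) (t := Finset.univ) fun k (_ : k ∈ Finset.univ) =>
      hperm (Equiv.addRight (k : Fin n)) fun i => (n : ℝ)⁻¹ * v i
    convert hsum using 1
    ext i
    have hs : ∑ k, v (i + k) = ∑ j, v j := Equiv.sum_comp (Equiv.addLeft i) v
    simp [Finset.sum_apply, Finset.sum_sub_distrib, ← Finset.mul_sum, hs, hn0]
  simpa using hmem fun _ => (n : ℝ)⁻¹ * ∑ j, v j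

end AffineInvariant

theorem affine_invariant_eq_on_scalar_with_same_det
    {n : ℕ} (hn : 1 ≤ n) {S : Type*} (f : Matrix (Fin n) (Fin n) ℝ → S)
    (hinv : ∀ (M N A : Matrix (Fin n) (Fin n) ℝ), M.PosDef → N.PosDef → IsUnit A →
      f M = f N → f (Aᵀ * M * A) = f (Aᵀ * N * A))
    (hsurj : ∀ y : S, ∃ s : ℝ, 0 < s ∧ f (s • (1 : Matrix (Fin n) (Fin n) ℝ)) = y) :
    ∀ (M : Matrix (Fin n) (Fin n) ℝ), M.PosDef →
      f M = f ((M.det ^ ((n : ℝ)⁻¹)) • (1 : Matrix (Fin n) (Fin n) ℝ)) := by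
  intro M hM
  set d := hM.isHermitian.eigenvalues
  have hpos : ∀ i, 0 < d i := hM.eigenvalues_pos
  set U : Matrix (Fin n) (Fin n) ℝ := (hM.isHermitian.eigenvectorUnitary).1
  have hUU : Uᵀ * U = 1 := by
    simpa [Matrix.star_eq_conjTranspose] using
      Unitary.coe_star_mul_self hM.isHermitian.eigenvectorUnitary
  have hdiag : Matrix.diagonal d = Uᵀ * M * U := by
    have h := hM.isHermitian.spectral_theorem
    rw [Unitary.conjStarAlgAut_apply] at h
    have h' : M = U * Matrix.diagonal d * Uᵀ := by
      simpa [Matrix.star_eq_conjTranspose, Function.comp_def] using h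
    rw [h']
    simp only [Matrix.mul_assoc, hUU, Matrix.mul_one]
    rw [← Matrix.mul_assoc, hUU, Matrix.one_mul]
  have hdet : M.det = ∏ i, d i := by simpa using hM.isHermitian.det_eq_prod_eigenvalues
  have hexp : (Matrix.diagonal fun i => Real.exp (Real.log (d i))) = Matrix.diagonal d := by
    simp [Real.exp_log (hpos _)]
  have hmean := map_diagonal_exp_eq_mean hinv hn hsurj fun i => Real.log (d i)
  rw [hexp, hdiag, map_orthogonal_conj hinv hsurj hM hUU] at hmean
  rw [hmean, Real.rpow_def_of_pos hM.det_pos, hdet, Real.log_prod fun i _ => (hpos i).ne',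
    Matrix.smul_one_eq_diagonal, mul_comm]
end

section
/- Let n ≥ 1 and let f : PD(n) → S be an affine invariant map satisfying the scalar surjectivity condition. Then the set K := {A ∈ GL(n) : f(AᵀA) = f(I)} is a normal subgroup of GL(n): it contains the identity, is closed under matrix multiplication and inversion, and for every A ∈ K and B ∈ GL(n), B A B⁻¹ ∈ K. -/
open scoped Matrix

theorem Matrix.posDef_transpose_mul_self_of_isUnit {n : ℕ} {A : Matrix (Fin n) (Fin n) ℝ}
    (hA : IsUnit A) : (Aᵀ * A).PosDef := by
  rw [← Matrix.conjTranspose_eq_transpose_of_trivial]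
  exact Matrix.PosDef.conjTranspose_mul_self A (Matrix.mulVec_injective_of_isUnit hA)

theorem affine_invariant_K_normal_subgroup
    {n : ℕ} (hn : 1 ≤ n) {S : Type*} (f : Matrix (Fin n) (Fin n) ℝ → S)
    (hinv : ∀ (M N A : Matrix (Fin n) (Fin n) ℝ), M.PosDef → N.PosDef → IsUnit A →
      f M = f N → f (Aᵀ * M * A) = f (Aᵀ * N * A))
    (hsurj : ∀ y : S, ∃ s : ℝ, 0 < s ∧ f (s • (1 : Matrix (Fin n) (Fin n) ℝ)) = y) :
    let K : Set (Matrix (Fin n) (Fin n) ℝ) :=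
      {A | IsUnit A ∧ f (Aᵀ * A) = f (1 : Matrix (Fin n) (Fin n) ℝ)}
    (1 : Matrix (Fin n) (Fin n) ℝ) ∈ K ∧
    (∀ A ∈ K, ∀ B ∈ K, A * B ∈ K) ∧
    (∀ A ∈ K, A⁻¹ ∈ K) ∧
    (∀ A ∈ K, ∀ B : Matrix (Fin n) (Fin n) ℝ, IsUnit B → B * A * B⁻¹ ∈ K) := by
  intro K
  have cancel {A : Matrix (Fin n) (Fin n) ℝ} (hA : IsUnit A) : A * A⁻¹ = 1 :=
    Matrix.mul_nonsing_inv A ((Matrix.isUnit_iff_isUnit_det A).mp hA)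
  have inv_unit {A : Matrix (Fin n) (Fin n) ℝ} (hA : IsUnit A) : IsUnit A⁻¹ :=
    Matrix.isUnit_nonsing_inv_iff.mpr hA
  have one_pos : (1 : Matrix (Fin n) (Fin n) ℝ).PosDef := Matrix.PosDef.one
  have gram_cancel {A : Matrix (Fin n) (Fin n) ℝ} (hA : IsUnit A) :
      (A⁻¹)ᵀ * (Aᵀ * A) * A⁻¹ = 1 := by
    rw [← Matrix.mul_assoc, ← Matrix.transpose_mul, cancel hA, Matrix.mul_assoc, cancel hA]
    simp
  refine ⟨⟨isUnit_one, by simp⟩, ?_, ?_, ?_⟩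
  · rintro A ⟨hA, hfA⟩ B ⟨hB, hfB⟩
    refine ⟨hA.mul hB, ?_⟩
    have h := hinv _ _ B (Matrix.posDef_transpose_mul_self_of_isUnit hA) one_pos hB hfA
    rw [Matrix.mul_one, hfB] at h
    simpa only [Matrix.transpose_mul, Matrix.mul_assoc] using h
  · rintro A ⟨hA, hfA⟩
    refine ⟨inv_unit hA, ?_⟩
    have h := hinv _ _ A⁻¹ (Matrix.posDef_transpose_mul_self_of_isUnit hA) one_pos
      (inv_unit hA) hfA
    rw [gram_cancel hA, Matrix.mul_one] at h
    exact h.symm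
  · rintro A ⟨hA, hfA⟩ B hB
    refine ⟨(hB.mul hA).mul (inv_unit hB), ?_⟩
    obtain ⟨s, hs, hfs⟩ := hsurj (f (Bᵀ * B))
    have hunit : IsUnit (√s • (1 : Matrix (Fin n) (Fin n) ℝ)) :=
      isUnit_one.smul (Units.mk0 (√s) (Real.sqrt_pos.mpr hs).ne')
    have hscale := hinv _ _ _ (Matrix.posDef_transpose_mul_self_of_isUnit hA) one_pos hunit hfA
    have hmove := hinv _ _ A (Matrix.posDef_transpose_mul_self_of_isUnit hB)
      (one_pos.smul hs) hA hfs.symm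
    simp only [Matrix.transpose_smul, Matrix.transpose_one, Matrix.smul_mul, Matrix.mul_smul,
      Matrix.one_mul, Matrix.mul_one, smul_smul, Real.mul_self_sqrt hs.le] at hscale hmove
    have hgram : f ((B * A)ᵀ * (B * A)) = f (Bᵀ * B) := by
      rw [← hfs, ← hscale, ← hmove]
      simp only [Matrix.transpose_mul, Matrix.mul_assoc]
    have h := hinv _ _ B⁻¹ (Matrix.posDef_transpose_mul_self_of_isUnit (hB.mul hA))
      (Matrix.posDef_transpose_mul_self_of_isUnit hB) (inv_unit hB) hgram
    rw [gram_cancel hB] at h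
    simpa only [Matrix.transpose_mul, Matrix.mul_assoc] using h
end

section
/- Let n ≥ 1 and let f : PD(n) → S be an affine invariant map satisfying the scalar surjectivity condition, and let K := {A ∈ GL(n) : f(AᵀA) = f(I)}. Then for all A, B ∈ GL(n), the matrix BᵀAᵀB⁻¹A⁻¹ belongs to K, i.e., f((BᵀAᵀB⁻¹A⁻¹)ᵀ(BᵀAᵀB⁻¹A⁻¹)) = f(I). -/
open scoped Matrix

open scoped MatrixOrder ComplexOrder in
/-- The positive square root of `Aᵀ * A`, the positive factor of the polar decomposition. -/
theorem Matrix.exists_symm_isUnit_mul_self_eq_transpose_mul_self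
    {n : Type*} [Fintype n] [DecidableEq n] {A : Matrix n n ℝ} (hA : IsUnit A) :
    ∃ P : Matrix n n ℝ, IsUnit P ∧ Pᵀ = P ∧ P * P = Aᵀ * A := by
  have hpos : 0 ≤ Aᵀ * A := by
    simpa using (Matrix.posSemidef_conjTranspose_mul_self A).nonneg
  have hmul : CFC.sqrt (Aᵀ * A) * CFC.sqrt (Aᵀ * A) = Aᵀ * A :=
    CFC.sqrt_mul_sqrt_self (Aᵀ * A) hpos
  refine ⟨CFC.sqrt (Aᵀ * A), ?_, ?_, hmul⟩
  · have h : IsUnit (CFC.sqrt (Aᵀ * A) * CFC.sqrt (Aᵀ * A)) := by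
      rw [hmul]
      exact ((Matrix.isUnit_transpose _).mpr hA).mul hA
    rw [Matrix.isUnit_iff_isUnit_det, Matrix.det_mul] at h
    exact (Matrix.isUnit_iff_isUnit_det _).mpr (isUnit_of_mul_isUnit_left h)
  · simpa using (Matrix.nonneg_iff_posSemidef.mp (CFC.sqrt_nonneg (Aᵀ * A))).isHermitian.eq

section AffineInvariant

variable {n : Type*} [Fintype n] [DecidableEq n] {S : Type*} {f : Matrix n n ℝ → S}

theorem Matrix.posDef_transpose_mul_self {A : Matrix n n ℝ} (hA : IsUnit A) :
    (Aᵀ * A).PosDef := by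
  simpa using Matrix.PosDef.conjTranspose_mul_self A (Matrix.mulVec_injective_iff_isUnit.mpr hA)

theorem affineInvariant_gram_mul_right
    (hinv : ∀ (M N A : Matrix n n ℝ), M.PosDef → N.PosDef → IsUnit A →
      f M = f N → f (Aᵀ * M * A) = f (Aᵀ * N * A))
    {A B C : Matrix n n ℝ} (hA : IsUnit A) (hB : IsUnit B) (hC : IsUnit C)
    (h : f (Aᵀ * A) = f (Bᵀ * B)) :
    f ((A * C)ᵀ * (A * C)) = f ((B * C)ᵀ * (B * C)) := by
  simpa only [Matrix.transpose_mul, Matrix.mul_assoc] using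
    hinv _ _ C (Matrix.posDef_transpose_mul_self hA) (Matrix.posDef_transpose_mul_self hB) hC h

theorem exists_scalar_gram_eq
    (hsurj : ∀ y : S, ∃ s : ℝ, 0 < s ∧ f (s • (1 : Matrix n n ℝ)) = y) (y : S) :
    ∃ r : ℝ, IsUnit (r • (1 : Matrix n n ℝ)) ∧
      f ((r • (1 : Matrix n n ℝ))ᵀ * (r • (1 : Matrix n n ℝ))) = y := by
  obtain ⟨s, hs, rfl⟩ := hsurj y
  refine ⟨√s, ?_, ?_⟩
  · exact isUnit_one.smul (Units.mk0 √s (Real.sqrt_pos.mpr hs).ne')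
  · simp [smul_smul, Real.mul_self_sqrt hs.le]

theorem affineInvariant_gram_mul_left
    (hinv : ∀ (M N A : Matrix n n ℝ), M.PosDef → N.PosDef → IsUnit A →
      f M = f N → f (Aᵀ * M * A) = f (Aᵀ * N * A))
    (hsurj : ∀ y : S, ∃ s : ℝ, 0 < s ∧ f (s • (1 : Matrix n n ℝ)) = y)
    {A B C : Matrix n n ℝ} (hA : IsUnit A) (hB : IsUnit B) (hC : IsUnit C)
    (h : f (Aᵀ * A) = f (Bᵀ * B)) :
    f ((C * A)ᵀ * (C * A)) = f ((C * B)ᵀ * (C * B)) := by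
  obtain ⟨r, hr, hrC⟩ := exists_scalar_gram_eq hsurj (f (Cᵀ * C))
  have hAB := affineInvariant_gram_mul_right hinv hA hB hr h
  have hCA := affineInvariant_gram_mul_right hinv hr hC hA hrC
  have hCB := affineInvariant_gram_mul_right hinv hr hC hB hrC
  simp only [Matrix.smul_mul, Matrix.mul_smul, Matrix.one_mul, Matrix.mul_one] at hAB hCA hCB
  rw [← hCA, hAB, hCB]

theorem affineInvariant_gram_mul_comm
    (hinv : ∀ (M N A : Matrix n n ℝ), M.PosDef → N.PosDef → IsUnit A →
      f M = f N → f (Aᵀ * M * A) = f (Aᵀ * N * A))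
    (hsurj : ∀ y : S, ∃ s : ℝ, 0 < s ∧ f (s • (1 : Matrix n n ℝ)) = y)
    {A B : Matrix n n ℝ} (hA : IsUnit A) (hB : IsUnit B) :
    f ((A * B)ᵀ * (A * B)) = f ((B * A)ᵀ * (B * A)) := by
  obtain ⟨r, hr, hrA⟩ := exists_scalar_gram_eq hsurj (f (Aᵀ * A))
  rw [← affineInvariant_gram_mul_right hinv hr hA hB hrA,
    ← affineInvariant_gram_mul_left hinv hsurj hr hA hB hrA]
  simp only [Matrix.smul_mul, Matrix.mul_smul, Matrix.one_mul, Matrix.mul_one]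

theorem affineInvariant_gram_transpose
    (hinv : ∀ (M N A : Matrix n n ℝ), M.PosDef → N.PosDef → IsUnit A →
      f M = f N → f (Aᵀ * M * A) = f (Aᵀ * N * A))
    (hsurj : ∀ y : S, ∃ s : ℝ, 0 < s ∧ f (s • (1 : Matrix n n ℝ)) = y)
    {A : Matrix n n ℝ} (hA : IsUnit A) :
    f (Aᵀᵀ * Aᵀ) = f (Aᵀ * A) := by
  obtain ⟨P, hP, hPt, hPA⟩ := Matrix.exists_symm_isUnit_mul_self_eq_transpose_mul_self hA
  have hAd := (Matrix.isUnit_iff_isUnit_det A).mp hA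
  have hA' : IsUnit A⁻¹ := Matrix.isUnit_nonsing_inv_iff.mpr hA
  -- `P * A⁻¹` is the inverse of the orthogonal factor of `A`.
  have hfactor : Aᵀ = P * (P * A⁻¹) := by
    rw [← Matrix.mul_assoc, hPA, Matrix.mul_nonsing_inv_cancel_right _ _ hAd]
  have horth : (P * A⁻¹)ᵀ * (P * A⁻¹) = 1 := by
    rw [Matrix.transpose_mul, hPt, Matrix.mul_assoc, ← hfactor, ← Matrix.transpose_mul,
      Matrix.mul_nonsing_inv _ hAd, Matrix.transpose_one]
  calc f (Aᵀᵀ * Aᵀ)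
      = f ((P * (P * A⁻¹))ᵀ * (P * (P * A⁻¹))) := by rw [← hfactor]
    _ = f ((P * A⁻¹ * P)ᵀ * (P * A⁻¹ * P)) :=
        affineInvariant_gram_mul_comm hinv hsurj hP (hP.mul hA')
    _ = f (Aᵀ * A) := by
        rw [Matrix.transpose_mul (P * A⁻¹) P, Matrix.mul_assoc, ← Matrix.mul_assoc (P * A⁻¹)ᵀ,
          horth, Matrix.one_mul, hPt, hPA]

end AffineInvariant

theorem affine_invariant_commutator_in_K
    {n : ℕ} (hn : 1 ≤ n) {S : Type*} (f : Matrix (Fin n) (Fin n) ℝ → S)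
    (hinv : ∀ (M N A : Matrix (Fin n) (Fin n) ℝ), M.PosDef → N.PosDef → IsUnit A →
      f M = f N → f (Aᵀ * M * A) = f (Aᵀ * N * A))
    (hsurj : ∀ y : S, ∃ s : ℝ, 0 < s ∧ f (s • (1 : Matrix (Fin n) (Fin n) ℝ)) = y) :
    ∀ (A B : Matrix (Fin n) (Fin n) ℝ), IsUnit A → IsUnit B →
      f ((Bᵀ * Aᵀ * B⁻¹ * A⁻¹)ᵀ * (Bᵀ * Aᵀ * B⁻¹ * A⁻¹)) =
        f (1 : Matrix (Fin n) (Fin n) ℝ) := by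
  intro A B hA hB
  have hAB := hA.mul hB
  have h := affineInvariant_gram_mul_right hinv ((Matrix.isUnit_transpose _).mpr hAB) hAB
    (Matrix.isUnit_nonsing_inv_iff.mpr hAB) (affineInvariant_gram_transpose hinv hsurj hAB)
  rw [Matrix.mul_nonsing_inv _ ((Matrix.isUnit_iff_isUnit_det _).mp hAB), Matrix.mul_inv_rev,
    Matrix.transpose_mul A B, ← Matrix.mul_assoc (Bᵀ * Aᵀ), Matrix.transpose_one,
    Matrix.one_mul] at h
  exact h
end

section
/- Let n ≥ 1 and let f : PD(n) → S be an affine invariant map satisfying the scalar surjectivity condition, with image of f equal to S, and let K := {A ∈ GL(n) : f(AᵀA) = f(I)} (a normal subgroup of GL(n)). Then there is a bijection b from the quotient group GL(n)/K onto S such that for every A ∈ GL(n), f(AᵀA) = b(AK), where AK denotes the image of A under the canonical map GL(n) → GL(n)/K. -/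
open scoped Matrix

/-- The Gram matrix of an invertible real matrix is positive definite. -/
theorem posDef_transpose_mul_self_of_GL {n : ℕ} (A : GL (Fin n) ℝ) :
    ((A : Matrix (Fin n) (Fin n) ℝ)ᵀ * (A : Matrix (Fin n) (Fin n) ℝ)).PosDef := by
  rw [← Matrix.conjTranspose_eq_transpose_of_trivial]
  exact Matrix.PosDef.conjTranspose_mul_self _
    (Matrix.mulVec_injective_iff_isUnit.mpr A.isUnit)

/-- An affine invariant map identifies the Gram matrices of `A * C` and `B * C` as soon as it
identifies those of `A` and `B`. -/
theorem gram_mul_right_eq {n : ℕ} {S : Type*} {f : Matrix (Fin n) (Fin n) ℝ → S}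
    (hinv : ∀ (M N A : Matrix (Fin n) (Fin n) ℝ), M.PosDef → N.PosDef → IsUnit A →
      f M = f N → f (Aᵀ * M * A) = f (Aᵀ * N * A))
    {A B : GL (Fin n) ℝ}
    (h : f ((A : Matrix (Fin n) (Fin n) ℝ)ᵀ * (A : Matrix (Fin n) (Fin n) ℝ)) =
      f ((B : Matrix (Fin n) (Fin n) ℝ)ᵀ * (B : Matrix (Fin n) (Fin n) ℝ)))
    (C : GL (Fin n) ℝ) :
    f (((A * C : GL (Fin n) ℝ) : Matrix (Fin n) (Fin n) ℝ)ᵀ *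
        ((A * C : GL (Fin n) ℝ) : Matrix (Fin n) (Fin n) ℝ)) =
      f (((B * C : GL (Fin n) ℝ) : Matrix (Fin n) (Fin n) ℝ)ᵀ *
        ((B * C : GL (Fin n) ℝ) : Matrix (Fin n) (Fin n) ℝ)) := by
  simpa only [Units.val_mul, Matrix.transpose_mul, Matrix.mul_assoc] using
    hinv _ _ _ (posDef_transpose_mul_self_of_GL A) (posDef_transpose_mul_self_of_GL B) C.isUnit h

theorem affine_invariant_bijection_with_quotient
    {n : ℕ} (hn : 1 ≤ n) {S : Type*} (f : Matrix (Fin n) (Fin n) ℝ → S)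
    (hinv : ∀ (M N A : Matrix (Fin n) (Fin n) ℝ), M.PosDef → N.PosDef → IsUnit A →
      f M = f N → f (Aᵀ * M * A) = f (Aᵀ * N * A))
    (hsurj : ∀ y : S, ∃ s : ℝ, 0 < s ∧ f (s • (1 : Matrix (Fin n) (Fin n) ℝ)) = y)
    (K : Subgroup (GL (Fin n) ℝ))
    (hK : ∀ A : GL (Fin n) ℝ, A ∈ K ↔
      f ((A : Matrix (Fin n) (Fin n) ℝ)ᵀ * (A : Matrix (Fin n) (Fin n) ℝ)) =
        f (1 : Matrix (Fin n) (Fin n) ℝ))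
    (hN : K.Normal) :
    ∃ b : (GL (Fin n) ℝ ⧸ K) → S,
      Function.Bijective b ∧
      ∀ A : GL (Fin n) ℝ,
        f ((A : Matrix (Fin n) (Fin n) ℝ)ᵀ * (A : Matrix (Fin n) (Fin n) ℝ)) =
          b (QuotientGroup.mk A) := by
  have key (A B : GL (Fin n) ℝ) :
      f ((A : Matrix (Fin n) (Fin n) ℝ)ᵀ * (A : Matrix (Fin n) (Fin n) ℝ)) =
        f ((B : Matrix (Fin n) (Fin n) ℝ)ᵀ * (B : Matrix (Fin n) (Fin n) ℝ)) ↔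
      A⁻¹ * B ∈ K := by
    rw [hN.mem_comm_iff, hK]
    constructor
    · intro h
      simpa using (gram_mul_right_eq hinv h A⁻¹).symm
    · intro h
      have h' := gram_mul_right_eq hinv (A := B * A⁻¹) (B := 1) (by simpa using h) A
      rw [inv_mul_cancel_right, one_mul] at h'
      exact h'.symm
  refine ⟨Quotient.lift
    (fun A : GL (Fin n) ℝ =>
      f ((A : Matrix (Fin n) (Fin n) ℝ)ᵀ * (A : Matrix (Fin n) (Fin n) ℝ)))
    fun A B h => (key A B).mpr (QuotientGroup.leftRel_apply.mp h), ⟨?_, ?_⟩, fun _ => rfl⟩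
  · rintro ⟨A⟩ ⟨B⟩ h
    exact QuotientGroup.eq.mpr ((key A B).mp h)
  · intro y
    obtain ⟨s, hs, rfl⟩ := hsurj y
    let u : ℝˣ := Units.mk0 (√s) (Real.sqrt_pos.mpr hs).ne'
    refine ⟨QuotientGroup.mk (u • (1 : GL (Fin n) ℝ)), ?_⟩
    change f (((√s) • (1 : Matrix (Fin n) (Fin n) ℝ))ᵀ * ((√s) • 1)) = _
    simp [smul_smul, Real.mul_self_sqrt hs.le]
end

section
/- Let n ≥ 1 and let f : PD(n) → S be an affine invariant map satisfying the scalar surjectivity condition, and let K := {A ∈ GL(n) : f(AᵀA) = f(I)}. Then K contains the special linear group SL(n): every A ∈ GL(n) with det(A) = 1 satisfies f(AᵀA) = f(I). -/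
open scoped Matrix

theorem exists_pos_eq_div_perm_of_prod_eq_one {n : ℕ} (d : Fin n → ℝ) (hpos : ∀ i, 0 < d i)
    (hprod : ∏ i, d i = 1) :
    ∃ (e : Fin n → ℝ) (σ : Equiv.Perm (Fin n)), (∀ i, 0 < e i) ∧ ∀ i, d i = e (σ i) / e i := by
  obtain _ | m := n
  · exact ⟨d, 1, hpos, fun i => i.elim0⟩
  have hp : ∀ i, 0 < Fin.partialProd d i := by
    intro i
    induction i using Fin.induction with
    | zero => simp
    | succ i ih => rw [Fin.partialProd_succ]; exact mul_pos ih (hpos i)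
  have hlast : Fin.partialProd d (Fin.last (m + 1)) = 1 := by
    rw [Fin.partialProd, ← hprod, List.take_of_length_le (by simp), List.prod_ofFn]
  refine ⟨fun i => Fin.partialProd d i.castSucc, Equiv.addRight 1, fun i => hp _, fun i => ?_⟩
  rw [eq_div_iff (hp _).ne', mul_comm, ← Fin.partialProd_succ]
  induction i using Fin.lastCases with
  | last => simp [hlast]
  | cast i => simp [Fin.coeSucc_eq_succ]

theorem Matrix.transpose_submatrix_one_mul_mul {n R : Type*} [Fintype n] [DecidableEq n]
    [NonAssocSemiring R] (M : Matrix n n R) (σ : Equiv.Perm n) :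
    ((1 : Matrix n n R).submatrix id σ)ᵀ * M * (1 : Matrix n n R).submatrix id σ =
      M.submatrix σ σ := by
  ext i j
  simp [Matrix.mul_apply, Matrix.one_apply]

theorem Matrix.isUnit_submatrix_one {n R : Type*} [Fintype n] [DecidableEq n]
    [CommRing R] (σ : Equiv.Perm n) : IsUnit ((1 : Matrix n n R).submatrix id σ) := by
  have h : ((1 : Matrix n n R).submatrix id σ)ᵀ * (1 : Matrix n n R).submatrix id σ = 1 := by
    simpa using Matrix.transpose_submatrix_one_mul_mul (1 : Matrix n n R) σ
  exact IsUnit.of_mul_eq_one_right _ h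

theorem affine_invariant_diagonal_eq_one {n : ℕ} {S : Type*}
    (f : Matrix (Fin n) (Fin n) ℝ → S)
    (hinv : ∀ (M N A : Matrix (Fin n) (Fin n) ℝ), M.PosDef → N.PosDef → IsUnit A →
      f M = f N → f (Aᵀ * M * A) = f (Aᵀ * N * A))
    (hsurj : ∀ y : S, ∃ s : ℝ, 0 < s ∧ f (s • (1 : Matrix (Fin n) (Fin n) ℝ)) = y)
    (d : Fin n → ℝ) (hpos : ∀ i, 0 < d i) (hprod : ∏ i, d i = 1) :
    f (Matrix.diagonal d) = f 1 := by
  obtain ⟨e, σ, he, hd⟩ := exists_pos_eq_div_perm_of_prod_eq_one d hpos hprod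
  obtain ⟨s, hs, hfs⟩ := hsurj (f (Matrix.diagonal e))
  have hE : (Matrix.diagonal e).PosDef := .diagonal he
  have hE' : (Matrix.diagonal (e ∘ σ)).PosDef := .diagonal fun i => he (σ i)
  have hI : (s • (1 : Matrix (Fin n) (Fin n) ℝ)).PosDef := Matrix.PosDef.one.smul hs
  have hperm := hinv _ _ _ hI hE (Matrix.isUnit_submatrix_one σ) hfs
  rw [Matrix.transpose_submatrix_one_mul_mul, Matrix.transpose_submatrix_one_mul_mul,
    Matrix.submatrix_diagonal_equiv, Matrix.smul_one_eq_diagonal,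
    Matrix.submatrix_diagonal_equiv] at hperm
  replace hperm : f (Matrix.diagonal e) = f (Matrix.diagonal (e ∘ σ)) := by
    rw [← hfs, Matrix.smul_one_eq_diagonal]
    exact hperm
  have hunit : IsUnit (Matrix.diagonal fun i => (√(e i))⁻¹) := by
    rw [Matrix.isUnit_diagonal, Pi.isUnit_iff]
    exact fun i => (inv_pos.2 (Real.sqrt_pos.2 (he i))).ne'.isUnit
  have h := hinv _ _ _ hE' hE hunit hperm.symm
  have hconj (a : Fin n → ℝ) : (Matrix.diagonal fun i => (√(e i))⁻¹)ᵀ * Matrix.diagonal a *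
      (Matrix.diagonal fun i => (√(e i))⁻¹) = Matrix.diagonal fun i => a i / e i := by
    rw [Matrix.diagonal_transpose, Matrix.diagonal_mul_diagonal, Matrix.diagonal_mul_diagonal]
    congr 1
    ext i
    rw [mul_right_comm, ← mul_inv, Real.mul_self_sqrt (he i).le, div_eq_inv_mul]
  rw [hconj, hconj] at h
  simpa [funext hd, div_self (he _).ne'] using h

theorem affine_invariant_K_contains_SL
    {n : ℕ} (hn : 1 ≤ n) {S : Type*} (f : Matrix (Fin n) (Fin n) ℝ → S)
    (hinv : ∀ (M N A : Matrix (Fin n) (Fin n) ℝ), M.PosDef → N.PosDef → IsUnit A →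
      f M = f N → f (Aᵀ * M * A) = f (Aᵀ * N * A))
    (hsurj : ∀ y : S, ∃ s : ℝ, 0 < s ∧ f (s • (1 : Matrix (Fin n) (Fin n) ℝ)) = y) :
    ∀ (A : Matrix (Fin n) (Fin n) ℝ), A.det = 1 →
      f (Aᵀ * A) = f (1 : Matrix (Fin n) (Fin n) ℝ) := by
  intro A hA
  have hM : (Aᵀ * A).PosDef := by
    rw [← Matrix.conjTranspose_eq_transpose_of_trivial]
    exact .conjTranspose_mul_self A (Matrix.mulVec_injective_of_isUnit
      ((Matrix.isUnit_iff_isUnit_det A).2 (by simp [hA])))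
  have hprod : ∏ i, hM.isHermitian.eigenvalues i = 1 := by
    have h := hM.isHermitian.det_eq_prod_eigenvalues
    simpa [hA] using h.symm
  have hdiag := affine_invariant_diagonal_eq_one f hinv hsurj _ hM.eigenvalues_pos hprod
  let U : Matrix (Fin n) (Fin n) ℝ := hM.isHermitian.eigenvectorUnitary.1
  have hUU : U * Uᵀ = 1 := by
    rw [← Matrix.conjTranspose_eq_transpose_of_trivial]
    exact Unitary.coe_mul_star_self hM.isHermitian.eigenvectorUnitary
  have h := hinv _ _ Uᵀ (.diagonal hM.eigenvalues_pos) .one (IsUnit.of_mul_eq_one_right _ hUU) hdiag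
  have hspec : Aᵀ * A = U * Matrix.diagonal hM.isHermitian.eigenvalues * Uᵀ := by
    have hs := hM.isHermitian.spectral_theorem
    rw [Unitary.conjStarAlgAut_apply, Matrix.star_eq_conjTranspose,
      Matrix.conjTranspose_eq_transpose_of_trivial] at hs
    exact hs
  rw [Matrix.transpose_transpose, ← hspec, mul_one, hUU] at h
  exact h
end

section
/- Let n ≥ 1 and let f : PD(n) → S be an affine invariant map satisfying the scalar surjectivity condition, and let K := {A ∈ GL(n) : f(AᵀA) = f(I)} (a normal subgroup of GL(n)). Then the canonical map GL(n) → GL(n)/K factors through the squared determinant: there is a group homomorphism H from the multiplicative group of positive reals (0,∞) to the quotient group GL(n)/K such that for every A ∈ GL(n), the coset AK equals H(det(A)²); moreover H is surjective, so GL(n)/K is isomorphic to the quotient group (0,∞)/ker(H). -/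
open scoped Matrix

namespace Matrix.GeneralLinearGroup

variable {n F Q : Type*} [Fintype n] [DecidableEq n] [Field F] [CommGroup Q]

/-- The embedding of tuples of units as invertible diagonal matrices. -/
def diagonalUnits (n F : Type*) [Fintype n] [DecidableEq n] [Field F] : (n → Fˣ) →* GL n F :=
  (Units.map (diagonalRingHom n F : (n → F) →* Matrix n n F)).comp
    (MulEquiv.piUnits (M := fun _ : n => F)).symm.toMonoidHom

theorem coe_diagonalUnits (d : n → Fˣ) :
    (diagonalUnits n F d : Matrix n n F) = diagonal fun i => (d i : F) :=
  rfl

theorem map_diagonalUnits_mulSingle (φ : GL n F →* Q) (i j : n) (x : Fˣ) :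
    φ (diagonalUnits n F (Pi.mulSingle i x)) = φ (diagonalUnits n F (Pi.mulSingle j x)) := by
  have h : swap F i j * diagonalUnits n F (Pi.mulSingle i x) =
      diagonalUnits n F (Pi.mulSingle j x) * swap F i j := by
    apply Units.ext
    ext a b
    change (Matrix.swap F i j * diagonal fun k => ((Pi.mulSingle i x : n → Fˣ) k : F)) a b =
      ((diagonal fun k => ((Pi.mulSingle j x : n → Fˣ) k : F)) * Matrix.swap F i j) a b
    simp only [mul_diagonal, diagonal_mul, Matrix.swap, Equiv.Perm.permMatrix,
      PEquiv.toMatrix_apply, Equiv.toPEquiv_apply, Option.mem_some_iff, Pi.mulSingle_apply]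
    by_cases hab : Equiv.swap i j a = b
    · subst hab
      have : Equiv.swap i j a = i ↔ a = j := by
        rw [Equiv.swap_apply_eq_iff, Equiv.swap_apply_left]
      simp [this, mul_comm]
    · simp [hab]
  have h' := congrArg φ h
  rw [map_mul, map_mul, mul_comm] at h'
  exact mul_right_cancel h'

theorem map_diagonalUnits (φ : GL n F →* Q) (i : n) (d : n → Fˣ) :
    φ (diagonalUnits n F d) = φ (diagonalUnits n F (Pi.mulSingle i (∏ k, d k))) := by
  have h := map_prod ((φ.comp (diagonalUnits n F)).comp (MonoidHom.mulSingle (fun _ => Fˣ) i))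
    d Finset.univ
  have h' := map_prod (φ.comp (diagonalUnits n F)) (fun k => Pi.mulSingle k (d k)) Finset.univ
  rw [Finset.univ_prod_mulSingle] at h'
  simp only [MonoidHom.comp_apply, MonoidHom.mulSingle_apply] at h h'
  rw [h, h']
  exact Finset.prod_congr rfl fun k _ => map_diagonalUnits_mulSingle φ k i (d k)

theorem map_eq_one_of_coe_eq_transvection (hF : ∃ c : F, c ≠ 0 ∧ c ≠ 1) (φ : GL n F →* Q)
    (t : TransvectionStruct n F) (A : GL n F) (hA : (A : Matrix n n F) = t.toMatrix) :
    φ A = 1 := by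
  obtain ⟨c, hc0, hc1⟩ := hF
  obtain ⟨i, j, hij, x⟩ := t
  have hc : c - 1 ≠ 0 := sub_ne_zero.2 hc1
  let B : GL n F := mkOfDetNeZero (transvection i j (x / (c - 1)))
    (by rw [det_transvection_of_ne i j hij]; exact one_ne_zero)
  let D : GL n F := diagonalUnits n F (Pi.mulSingle i (Units.mk0 c hc0))
  have h : D * B = A * B * D := by
    apply Units.ext
    change (D : Matrix n n F) * transvection i j (x / (c - 1)) =
      A * transvection i j (x / (c - 1)) * D
    rw [hA, TransvectionStruct.toMatrix_mk, transvection_mul_transvection_same i j hij,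
      coe_diagonalUnits]
    ext a b
    rw [diagonal_mul, mul_diagonal]
    simp only [transvection, add_apply, one_apply, single_apply, Pi.mulSingle_apply]
    by_cases hb : b = j
    · subst hb
      by_cases ha : a = i
      · subst ha
        simp [hij, hij.symm]
        field_simp
        ring
      · by_cases hab : a = b <;> simp [Ne.symm ha, hab, hij]
    · by_cases hab : a = b <;> simp [hab, Ne.symm hb]
  have h' := congrArg φ h
  rw [map_mul, map_mul, map_mul, mul_comm (φ D), mul_assoc] at h'
  exact right_eq_mul.1 h'

/-- Over a field with more than two elements, every homomorphism from the general linear group to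
a commutative group factors through the determinant. -/
theorem exists_eq_comp_det [Nonempty n] (hF : ∃ c : F, c ≠ 0 ∧ c ≠ 1) (φ : GL n F →* Q) :
    ∃ ψ : Fˣ →* Q, φ = ψ.comp det := by
  obtain ⟨i⟩ := ‹Nonempty n›
  let ψ : Fˣ →* Q :=
    (φ.comp (diagonalUnits n F)).comp (MonoidHom.mulSingle (fun _ => Fˣ) i)
  refine ⟨ψ, ?_⟩
  suffices h : ∀ A : GL n F, ∀ B : GL n F, (B : Matrix n n F) = A → φ B = ψ (det B) from
    MonoidHom.ext fun A => h A A rfl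
  intro A
  refine diagonal_transvection_induction_of_det_ne_zero
    (fun M => ∀ B : GL n F, (B : Matrix n n F) = M → φ B = ψ (det B)) A A.det_ne_zero ?_ ?_ ?_
  · intro d hd B hB
    rw [det_diagonal, Finset.prod_ne_zero_iff] at hd
    have hBd : B = diagonalUnits n F fun k => Units.mk0 (d k) (hd k (Finset.mem_univ k)) :=
      Units.ext hB
    have hdet : det B = ∏ k, Units.mk0 (d k) (hd k (Finset.mem_univ k)) := by
      apply Units.ext
      simp [hB, Units.coe_prod]
    rw [hdet, hBd, map_diagonalUnits φ i]
    rfl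
  · intro t B hB
    have hdet : det B = 1 := by
      apply Units.ext
      simp [hB]
    rw [map_eq_one_of_coe_eq_transvection hF φ t B hB, hdet, map_one]
  · intro M N hM hN ihM ihN B hB
    have hBMN : B = mkOfDetNeZero M hM * mkOfDetNeZero N hN := Units.ext hB
    rw [hBMN, map_mul, map_mul, map_mul, ihM _ rfl, ihN _ rfl]

end Matrix.GeneralLinearGroup

open Matrix.GeneralLinearGroup in
theorem affine_invariant_quotient_factors_through_det_sq
    {n : ℕ} (hn : 1 ≤ n) {S : Type*} (f : Matrix (Fin n) (Fin n) ℝ → S)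
    (hinv : ∀ (M N A : Matrix (Fin n) (Fin n) ℝ), M.PosDef → N.PosDef → IsUnit A →
      f M = f N → f (Aᵀ * M * A) = f (Aᵀ * N * A))
    (hsurj : ∀ y : S, ∃ s : ℝ, 0 < s ∧ f (s • (1 : Matrix (Fin n) (Fin n) ℝ)) = y)
    (K : Subgroup (GL (Fin n) ℝ))
    (hK : ∀ A : GL (Fin n) ℝ, A ∈ K ↔
      f ((A : Matrix (Fin n) (Fin n) ℝ)ᵀ * (A : Matrix (Fin n) (Fin n) ℝ)) =
        f (1 : Matrix (Fin n) (Fin n) ℝ))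
    (hN : K.Normal) :
    ∃ H : {x : ℝ // 0 < x} →* (GL (Fin n) ℝ ⧸ K),
      Function.Surjective H ∧
      (∀ (A : GL (Fin n) ℝ) (h : 0 < (A : Matrix (Fin n) (Fin n) ℝ).det ^ 2),
        (QuotientGroup.mk A : GL (Fin n) ℝ ⧸ K) =
          H ⟨(A : Matrix (Fin n) (Fin n) ℝ).det ^ 2, h⟩) ∧
      Nonempty (({x : ℝ // 0 < x} ⧸ H.ker) ≃* (GL (Fin n) ℝ ⧸ K)) := by
  have hne : Nonempty (Fin n) := ⟨⟨0, hn⟩⟩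
  have hscalar (A : GL (Fin n) ℝ) : ∃ u : ℝˣ,
      (QuotientGroup.mk A : GL (Fin n) ℝ ⧸ K) = QuotientGroup.mk (scalar (Fin n) u) := by
    obtain ⟨s, hs, hfs⟩ := hsurj (f ((A : Matrix (Fin n) (Fin n) ℝ)ᵀ * A))
    have hs' : √s ≠ 0 := (Real.sqrt_pos.2 hs).ne'
    let u : ℝˣ := Units.mk0 √s hs'
    have hu : ((scalar (Fin n) u⁻¹ : GL (Fin n) ℝ) : Matrix (Fin n) (Fin n) ℝ) =
        (√s)⁻¹ • (1 : Matrix (Fin n) (Fin n) ℝ) := by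
      rw [coe_scalar, Matrix.smul_one_eq_diagonal, Matrix.scalar_apply]
      simp [u]
    refine ⟨u, (QuotientGroup.eq.2 ?_).symm⟩
    have hpos : ((A : Matrix (Fin n) (Fin n) ℝ)ᵀ * A).PosDef := by
      rw [← Matrix.conjTranspose_eq_transpose_of_trivial]
      exact Matrix.PosDef.conjTranspose_mul_self _
        (Matrix.mulVec_injective_of_isUnit A.isUnit)
    have h := hinv _ _ _ hpos (Matrix.PosDef.one.smul hs)
      (scalar (Fin n) u⁻¹ : GL (Fin n) ℝ).isUnit hfs.symm
    rw [← map_inv, hK, Units.val_mul, hu]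
    rw [hu] at h
    have hss : s * ((√s)⁻¹ * (√s)⁻¹) = 1 := by
      field_simp
      exact (Real.sq_sqrt hs.le).symm
    simpa [smul_smul, hss, mul_comm, mul_assoc, mul_left_comm] using h
  have hcomm (a b : GL (Fin n) ℝ ⧸ K) : a * b = b * a := by
    induction a using QuotientGroup.induction_on with | _ A
    obtain ⟨u, hu⟩ := hscalar A
    induction b using QuotientGroup.induction_on with | _ B
    rw [hu, ← QuotientGroup.mk_mul, ← QuotientGroup.mk_mul, scalar_commute]
  let _ : CommGroup (GL (Fin n) ℝ ⧸ K) :=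
    { (inferInstance : Group (GL (Fin n) ℝ ⧸ K)) with mul_comm := hcomm }
  obtain ⟨ψ, hψ⟩ := exists_eq_comp_det ⟨(2 : ℝ), by norm_num, by norm_num⟩ (QuotientGroup.mk' K)
  have hmk (A : GL (Fin n) ℝ) : (QuotientGroup.mk A : GL (Fin n) ℝ ⧸ K) = ψ (det A) :=
    DFunLike.congr_fun hψ A
  have hneg : ψ (-1) = 1 := by
    let i : Fin n := ⟨0, hn⟩
    let R := diagonalUnits (Fin n) ℝ (Pi.mulSingle i (-1))
    have hdet : det R = -1 := by
      apply Units.ext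
      simp only [val_det_apply, R, coe_diagonalUnits, Matrix.det_diagonal]
      rw [← Units.coe_prod, Finset.prod_pi_mulSingle']
      simp
    rw [← hdet, ← hmk, QuotientGroup.eq_one_iff, hK]
    congr 1
    simp only [R, coe_diagonalUnits, Matrix.diagonal_transpose, Matrix.diagonal_mul_diagonal]
    rw [← Matrix.diagonal_one]
    congr 1
    funext k
    by_cases hk : k = i <;> simp [hk]
  let H : {x : ℝ // 0 < x} →* GL (Fin n) ℝ ⧸ K := ψ.comp
    { toFun := fun x => Units.mk0 √x.1 (Real.sqrt_pos.2 x.2).ne'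
      map_one' := by
        apply Units.ext
        simp
      map_mul' := fun x y => by
        apply Units.ext
        simp [Real.sqrt_mul x.2.le] }
  have hH (A : GL (Fin n) ℝ) (h : 0 < (A : Matrix (Fin n) (Fin n) ℝ).det ^ 2) :
      (QuotientGroup.mk A : GL (Fin n) ℝ ⧸ K) =
        H ⟨(A : Matrix (Fin n) (Fin n) ℝ).det ^ 2, h⟩ := by
    let v : ℝˣ := Units.mk0 √((A : Matrix (Fin n) (Fin n) ℝ).det ^ 2) (Real.sqrt_pos.2 h).ne'
    change _ = ψ v
    have hv : det A = v ∨ det A = -1 * v := by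
      rcases abs_choice (A : Matrix (Fin n) (Fin n) ℝ).det with habs | habs
      · left
        apply Units.ext
        simp [v, Real.sqrt_sq_eq_abs, habs]
      · right
        apply Units.ext
        simp [v, Real.sqrt_sq_eq_abs, habs]
    rw [hmk]
    rcases hv with hv | hv
    · rw [hv]
    · rw [hv, map_mul, hneg, one_mul]
  have hHsurj : Function.Surjective H := fun q => by
    induction q using QuotientGroup.induction_on with | _ A
    exact ⟨_, (hH A (sq_pos_of_ne_zero A.det_ne_zero)).symm⟩
  exact ⟨H, hHsurj, hH, ⟨QuotientGroup.quotientKerEquivOfSurjective H hHsurj⟩⟩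
end

section
/- Let n ≥ 1 and let f : PD(n) → S be an affine invariant map satisfying the scalar surjectivity condition, and let K := {A ∈ GL(n) : f(AᵀA) = f(I)}. Then the quotient group GL(n)/K is abelian; equivalently, for all A, B ∈ GL(n), the commutator ABA⁻¹B⁻¹ belongs to K. -/
open scoped Matrix

/-- If `f` identifies the Gram matrices of `A` and `B` with the scalar matrices `s` and `t`,
then it identifies the Gram matrix of `A * B` with the scalar matrix `s * t`. -/
theorem affine_invariant_gram_mul {n : ℕ} {S : Type*} (f : Matrix (Fin n) (Fin n) ℝ → S)
    (hinv : ∀ (M N A : Matrix (Fin n) (Fin n) ℝ), M.PosDef → N.PosDef → IsUnit A →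
      f M = f N → f (Aᵀ * M * A) = f (Aᵀ * N * A))
    {A B : Matrix (Fin n) (Fin n) ℝ} (hA : IsUnit A) (hB : IsUnit B) {s t : ℝ}
    (hs : 0 < s) (ht : 0 < t) (hfA : f (Aᵀ * A) = f (s • 1)) (hfB : f (Bᵀ * B) = f (t • 1)) :
    f ((A * B)ᵀ * (A * B)) = f ((s * t) • 1) := by
  have hscale : IsUnit (√s • (1 : Matrix (Fin n) (Fin n) ℝ)) :=
    isUnit_one.smul (Units.mk0 √s (Real.sqrt_pos.2 hs).ne')
  have h₁ := hinv _ _ B (Matrix.posDef_transpose_mul_self_of_isUnit hA)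
    (Matrix.PosDef.one.smul hs) hB hfA
  have h₂ := hinv _ _ _ (Matrix.posDef_transpose_mul_self_of_isUnit hB)
    (Matrix.PosDef.one.smul ht) hscale hfB
  simp only [Matrix.transpose_smul, Matrix.transpose_one, Matrix.smul_mul, Matrix.mul_smul,
    Matrix.one_mul, Matrix.mul_one, smul_smul, Real.mul_self_sqrt hs.le] at h₁ h₂
  rw [Matrix.transpose_mul, Matrix.mul_assoc, ← Matrix.mul_assoc Aᵀ, ← Matrix.mul_assoc, h₁, h₂]
  congr 2
  rw [mul_left_comm, ← mul_assoc, mul_comm t, mul_right_comm, Real.mul_self_sqrt hs.le]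

theorem affine_invariant_quotient_abelian
    {n : ℕ} (hn : 1 ≤ n) {S : Type*} (f : Matrix (Fin n) (Fin n) ℝ → S)
    (hinv : ∀ (M N A : Matrix (Fin n) (Fin n) ℝ), M.PosDef → N.PosDef → IsUnit A →
      f M = f N → f (Aᵀ * M * A) = f (Aᵀ * N * A))
    (hsurj : ∀ y : S, ∃ s : ℝ, 0 < s ∧ f (s • (1 : Matrix (Fin n) (Fin n) ℝ)) = y) :
    ∀ (A B : Matrix (Fin n) (Fin n) ℝ), IsUnit A → IsUnit B →
      f ((A * B * A⁻¹ * B⁻¹)ᵀ * (A * B * A⁻¹ * B⁻¹)) =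
        f (1 : Matrix (Fin n) (Fin n) ℝ) := by
  intro A B hA hB
  obtain ⟨s, hs, hfA⟩ := hsurj (f (Aᵀ * A))
  obtain ⟨t, ht, hfB⟩ := hsurj (f (Bᵀ * B))
  have hAB := affine_invariant_gram_mul f hinv hA hB hs ht hfA.symm hfB.symm
  have hBA := affine_invariant_gram_mul f hinv hB hA ht hs hfB.symm hfA.symm
  rw [mul_comm t s, ← hAB] at hBA
  have hcancel : B * A * (B * A)⁻¹ = 1 :=
    Matrix.mul_nonsing_inv _ ((Matrix.isUnit_iff_isUnit_det _).1 (hB.mul hA))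
  have h := hinv _ _ (B * A)⁻¹ (Matrix.posDef_transpose_mul_self_of_isUnit (hA.mul hB))
    (Matrix.posDef_transpose_mul_self_of_isUnit (hB.mul hA))
    (Matrix.isUnit_nonsing_inv_iff.2 (hB.mul hA)) hBA.symm
  have hgram (M C : Matrix (Fin n) (Fin n) ℝ) :
      Cᵀ * (Mᵀ * M) * C = (M * C)ᵀ * (M * C) := by
    simp only [Matrix.transpose_mul, Matrix.mul_assoc]
  rw [hgram, hgram, hcancel, Matrix.transpose_one, Matrix.one_mul, Matrix.mul_inv_rev] at h
  rwa [Matrix.mul_assoc (A * B)]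
end

section
/- Let F be a field, and suppose that either n ≥ 3 or F has at least three elements. Then the derived (commutator) subgroup of the general linear group GL(n, F) equals the special linear group SL(n, F), the subgroup of matrices of determinant 1. -/
open scoped Matrix

open scoped commutatorElement in
theorem mem_commutator_of_mul_mul_eq {G : Type*} [Group G] {x a b : G}
    (h : x * (b * a) = a * b) : x ∈ commutator G := by
  rw [show x = ⁅a, b⁆ by rw [commutatorElement_def, ← h]; group]
  exact Subgroup.commutator_mem_commutator (Subgroup.mem_top _) (Subgroup.mem_top _)

theorem exists_ne_zero_ne_one {F : Type*} [Zero F] [One F]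
    (h : ∃ a b c : F, a ≠ b ∧ a ≠ c ∧ b ≠ c) : ∃ a : F, a ≠ 0 ∧ a ≠ 1 := by
  obtain ⟨a, b, c, hab, hac, hbc⟩ := h
  by_contra! H
  have H' (x : F) : x = 0 ∨ x = 1 := or_iff_not_imp_left.2 (H x)
  rcases H' a with ha | ha <;> rcases H' b with hb | hb <;> rcases H' c with hc | hc <;> simp_all

namespace Matrix.SpecialLinearGroup

variable {ι F : Type*} [Fintype ι] [DecidableEq ι] [Field F]

theorem transvection_toGL_mem_commutator_of_ne {i j k : ι} (hij : i ≠ j) (hik : i ≠ k)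
    (hkj : k ≠ j) (c : F) : toGL (transvection hij c) ∈ commutator (GL ι F) := by
  refine mem_commutator_of_mul_mul_eq (a := toGL (transvection hik c))
    (b := toGL (transvection hkj 1)) (Units.ext ?_)
  simp [transvection_coe, mul_add, add_mul, hij.symm, hkj.symm]
  abel

/-- The diagonal matrix with entry `c` in position `(i, i)` and all other diagonal entries `1`. -/
noncomputable def diagUpdate (i : ι) {c : F} (hc : c ≠ 0) : GL ι F :=
  GeneralLinearGroup.mkOfDetNeZero (diagonal (Function.update 1 i c)) (by
    simp [det_diagonal, Finset.prod_update_of_mem, hc])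

theorem coe_diagUpdate (i : ι) {c : F} (hc : c ≠ 0) :
    (diagUpdate i hc : Matrix ι ι F) = diagonal (Function.update 1 i c) := rfl

theorem transvection_toGL_mem_commutator_of_ne_one {i j : ι} (hij : i ≠ j) {a : F} (ha : a ≠ 0)
    (ha' : a ≠ 1) (c : F) : toGL (transvection hij c) ∈ commutator (GL ι F) := by
  have h1 : a - 1 ≠ 0 := sub_ne_zero.2 ha'
  refine mem_commutator_of_mul_mul_eq (a := diagUpdate i ha)
    (b := toGL (transvection hij (c / (a - 1)))) (Units.ext ?_)
  have hc : a * (c / (a - 1)) = c + c / (a - 1) := by field_simp; ring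
  have hl (x : F) : diagonal (Function.update 1 i a) * single i j x = single i j (a * x) := by
    ext k l
    simp [single_apply, Function.update_apply]
    grind
  have hr (x : F) : single i j x * diagonal (Function.update 1 i a) = single i j x := by
    ext k l
    simp [single_apply, Function.update_apply]
    grind
  simp [transvection_coe, coe_diagUpdate, mul_add, add_mul, hl, hr, hij.symm, hc, single_add]
  abel

theorem diag2n_toGL_mem_commutator {i j : ι} (hij : i ≠ j) {c : F} (hc : c ≠ 0) :
    toGL (diag2n hij c hc) ∈ commutator (GL ι F) := by
  refine mem_commutator_of_mul_mul_eq (a := diagUpdate i hc)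
    (b := GeneralLinearGroup.swap F i j) (Units.ext ?_)
  ext k l
  simp [coe_diagUpdate, diag2n_coe, swap, Function.update_apply, PEquiv.toMatrix_apply,
    Equiv.swap_apply_def]
  grind

theorem toGL_mem_commutator
    (h : 3 ≤ Fintype.card ι ∨ ∃ a : F, a ≠ 0 ∧ a ≠ 1) (A : SpecialLinearGroup ι F) :
    toGL A ∈ commutator (GL ι F) := by
  cases subsingleton_or_nontrivial ι
  · rw [Subsingleton.elim A 1, map_one]
    exact one_mem _
  refine diagonal_transvection_induction' (fun A ↦ toGL A ∈ commutator (GL ι F)) A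
    (fun i j hij c hc ↦ diag2n_toGL_mem_commutator hij hc) (fun i j hij c ↦ ?_)
    fun A B hA hB ↦ by rw [map_mul]; exact mul_mem hA hB
  obtain h | ⟨a, ha, ha'⟩ := h
  · obtain ⟨k, -, hk⟩ := Finset.exists_mem_notMem_of_card_lt_card
      (s := {i, j}) (t := (Finset.univ : Finset ι))
      (Finset.card_le_two.trans_lt (by rwa [Finset.card_univ]))
    simp only [Finset.mem_insert, Finset.mem_singleton, not_or] at hk
    exact transvection_toGL_mem_commutator_of_ne hij (Ne.symm hk.1) hk.2 c
  · exact transvection_toGL_mem_commutator_of_ne_one hij ha ha' c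

end Matrix.SpecialLinearGroup

theorem commutator_GL_eq_SL
    {n : ℕ} {F : Type*} [Field F]
    (h : 3 ≤ n ∨ ∃ a b c : F, a ≠ b ∧ a ≠ c ∧ b ≠ c) :
    ∀ A : GL (Fin n) F,
      A ∈ commutator (GL (Fin n) F) ↔ (A : Matrix (Fin n) (Fin n) F).det = 1 := by
  intro A
  refine ⟨fun hA ↦ ?_, fun hA ↦ ?_⟩
  · have := Abelianization.commutator_subset_ker Matrix.GeneralLinearGroup.det hA
    simpa [MonoidHom.mem_ker, Units.ext_iff] using this
  · have key := Matrix.SpecialLinearGroup.toGL_mem_commutator (ι := Fin n) (F := F)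
      (h.imp (by simp) (exists_ne_zero_ne_one)) ⟨A, hA⟩
    rwa [show Matrix.SpecialLinearGroup.toGL ⟨A, hA⟩ = A from Units.ext rfl] at key
end
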